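/- Let F_q be a finite field with q elements, k ≥ 2 a fixed integer, and ω_k(f) the number of monic irreducible factors of f with multiplicity exactly k. Then ω_k does not have normal order G for any non-decreasing function G : M → ℝ_{≥0}, where M is the set of monic polynomials of positive degree; i.e., there exists ε > 0 such that the number of degree-n monic f with |ω_k(f) - G(f)| > εG(f) (or with ω_k(f) ≠ 0 = G(f) interpretation: failing (1-ε)G(f) ≤ ω_k(f) ≤ (1+ε)G(f)) is not o(q^n) as n → ∞. -/

import Mathlib

open Filter Asymptotics Real Polynomial

/-- number of monic irreducible polynomials of degree r in F[t] -/
noncomputable def piq (F : Type*) [Field F] [Fintype F] (r : ℕ) : ℕ :=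
  Nat.card {l : Polynomial F // l.Monic ∧ Irreducible l ∧ l.natDegree = r}

/-- the constant A₁ = γ + Σ_{r≥1} (π_q(r) - q^r/r) q^{-r} -/
noncomputable def A1 (F : Type*) [Field F] [Fintype F] : ℝ :=
  Real.eulerMascheroniConstant +
    ∑' r : ℕ, if r = 0 then 0 else
      ((piq F r : ℝ) - (Fintype.card F : ℝ) ^ r / r) * ((Fintype.card F : ℝ) ^ r)⁻¹

/-- L(m) = Σ_{l ∈ P} |l|^{-m} -/
noncomputable def Lc (F : Type*) [Field F] [Fintype F] (m : ℕ) : ℝ :=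
  ∑' l : {l : Polynomial F // l.Monic ∧ Irreducible l},
    (((Fintype.card F : ℝ) ^ (l : Polynomial F).natDegree) ^ m)⁻¹

/-- ω_k(f): the number of distinct monic irreducible factors of f with multiplicity exactly k -/
noncomputable def omegak (F : Type*) [Field F] [Fintype F] (k : ℕ) (f : Polynomial F) : ℕ :=
  Nat.card {l : Polynomial F // l.Monic ∧ Irreducible l ∧ l ^ k ∣ f ∧ ¬ l ^ (k + 1) ∣ f}

/-- monic polynomials of degree n -/
def MM (F : Type*) [Field F] (n : ℕ) : Set (Polynomial F) := {f | f.Monic ∧ f.natDegree = n}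

lemma MM_card (F : Type*) [Field F] [Fintype F] (n : ℕ) :
    Nat.card (MM F n) = Fintype.card F ^ n := by
  have e : (MM F n) ≃ (Fin n → F) :=
    (Polynomial.monicEquivDegreeLT (R := F) n).trans (Polynomial.degreeLTEquiv F n).toEquiv
  rw [Nat.card_congr e, Nat.card_eq_fintype_card]
  simp

lemma MM_finite (F : Type*) [Field F] [Fintype F] (n : ℕ) : (MM F n).Finite := by
  have : Nat.card (MM F n) ≠ 0 := by
    rw [MM_card]; exact pow_ne_zero _ Fintype.card_ne_zero
  exact Set.finite_coe_iff.mp (Nat.finite_of_card_ne_zero this)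

lemma MM_ncard (F : Type*) [Field F] [Fintype F] (n : ℕ) :
    (MM F n).ncard = Fintype.card F ^ n := by
  rw [← Nat.card_coe_set_eq, MM_card]

/-- irreducible monic polynomials of degree d -/
def PP (F : Type*) [Field F] (d : ℕ) : Set (Polynomial F) :=
  {f | f.Monic ∧ Irreducible f ∧ f.natDegree = d}

lemma PP_sub (F : Type*) [Field F] (d : ℕ) : PP F d ⊆ MM F d := fun _ h => ⟨h.1, h.2.2⟩

lemma PP_ncard_one (F : Type*) [Field F] [Fintype F] :
    (PP F 1).ncard ≤ Fintype.card F := by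
  have := Set.ncard_le_ncard (PP_sub F 1) (MM_finite F 1)
  rwa [MM_ncard, pow_one] at this

lemma PP_ncard (F : Type*) [Field F] [Fintype F] (d : ℕ) (hd : 1 ≤ d) :
    (PP F (d + 1)).ncard ≤ Fintype.card F ^ d * (Fintype.card F - 1) := by
  have h1 : ((MM F d) ×ˢ ({0}ᶜ : Set F)).ncard = Fintype.card F ^ d * (Fintype.card F - 1) := by
    rw [Set.ncard_prod, MM_ncard, Set.ncard_compl, Set.ncard_singleton, Nat.card_eq_fintype_card]
  rw [← h1]
  refine Set.ncard_le_ncard_of_injOn (fun l => (l.divX, l.coeff 0)) ?_ ?_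
    ((MM_finite F d).prod (Set.toFinite _))
  · rintro l ⟨hm, hi, hdeg⟩
    refine ⟨⟨?_, ?_⟩, ?_⟩
    · have : l.divX.natDegree = d := by rw [Polynomial.natDegree_divX_eq_natDegree_tsub_one]; omega
      simp only [Polynomial.Monic, Polynomial.leadingCoeff]
      rw [this, Polynomial.coeff_divX, ← hdeg]
      exact hm
    · show l.divX.natDegree = d
      rw [Polynomial.natDegree_divX_eq_natDegree_tsub_one]; omega
    · show l.coeff 0 ≠ 0
      intro h0
      have hX : (X : F[X]) ∣ l := Polynomial.X_dvd_iff.mpr h0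
      have := (Polynomial.irreducible_X (R := F)).associated_of_dvd hi hX
      have h2 := Polynomial.natDegree_eq_of_degree_eq (Polynomial.degree_eq_degree_of_associated this)
      rw [Polynomial.natDegree_X] at h2
      omega
  · intro a _ b _ hab
    simp only [Prod.mk.injEq] at hab
    rw [← Polynomial.divX_mul_X_add a, ← Polynomial.divX_mul_X_add b, hab.1, hab.2]

/-- divisible by the square of an irreducible of degree d -/
def BB (F : Type*) [Field F] (n d : ℕ) : Set (Polynomial F) :=
  {f | f ∈ MM F n ∧ ∃ l ∈ PP F d, l ^ 2 ∣ f}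

lemma BB_ncard (F : Type*) [Field F] [Fintype F] (n d : ℕ) :
    (BB F n d).ncard ≤ (PP F d).ncard * Fintype.card F ^ (n - 2 * d) := by
  rw [← MM_ncard, ← Set.ncard_prod]
  have hfin : ((PP F d) ×ˢ (MM F (n - 2 * d))).Finite :=
    ((MM_finite F d).subset (PP_sub F d)).prod (MM_finite F _)
  refine le_trans (Set.ncard_le_ncard (t := (fun p : F[X] × F[X] => p.1 ^ 2 * p.2) ''
    ((PP F d) ×ˢ (MM F (n - 2 * d)))) ?_ (hfin.image _)) (Set.ncard_image_le hfin)
  rintro f ⟨⟨hm, hdeg⟩, l, hl, g, rfl⟩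
  have hg : g.Monic := (hl.1.pow 2).of_mul_monic_left hm
  refine ⟨(l, g), ⟨hl, hg, ?_⟩, rfl⟩
  rw [(hl.1.pow 2).natDegree_mul hg, hl.1.natDegree_pow, hl.2.2] at hdeg
  show g.natDegree = _
  omega

/-- divisible by the square of an irreducible -/
def SS (F : Type*) [Field F] (n : ℕ) : Set (Polynomial F) :=
  {f | f ∈ MM F n ∧ ∃ l : F[X], l.Monic ∧ Irreducible l ∧ l ^ 2 ∣ f}

lemma BB_empty (F : Type*) [Field F] (n d : ℕ) (h : n < 2 * d) : BB F n d = ∅ := by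
  ext f
  simp only [Set.mem_empty_iff_false, iff_false]
  rintro ⟨⟨hm, hdeg⟩, l, hl, hdvd⟩
  have := Polynomial.natDegree_le_of_dvd hdvd hm.ne_zero
  rw [hl.1.natDegree_pow, hl.2.2] at this
  omega

lemma BB_real_one (F : Type*) [Field F] [Fintype F] (n : ℕ) :
    ((BB F n 1).ncard : ℝ) ≤ (Fintype.card F : ℝ) ^ n * ((Fintype.card F : ℝ)⁻¹) := by
  have hq : (0 : ℝ) < Fintype.card F := by exact_mod_cast Fintype.card_pos
  by_cases h : n < 2 * 1
  · rw [BB_empty F n 1 h]; simp; positivity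
  obtain ⟨m, rfl⟩ : ∃ m, n = m + 2 := ⟨n - 2, by omega⟩
  have h1 := (BB_ncard F (m + 2) 1).trans (Nat.mul_le_mul_right _ (PP_ncard_one F))
  have h2 : ((BB F (m + 2) 1).ncard : ℝ) ≤ (Fintype.card F : ℝ) * (Fintype.card F : ℝ) ^ m := by
    exact_mod_cast h1
  refine h2.trans (le_of_eq ?_)
  field_simp
  ring

lemma BB_real (F : Type*) [Field F] [Fintype F] (n d : ℕ) (hd : 1 ≤ d) :
    ((BB F n (d + 1)).ncard : ℝ) ≤ (Fintype.card F : ℝ) ^ n *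
      ((Fintype.card F : ℝ)⁻¹ ^ (d + 1) - (Fintype.card F : ℝ)⁻¹ ^ (d + 2)) := by
  have hq : (1 : ℝ) ≤ Fintype.card F := by exact_mod_cast Fintype.card_pos
  have hq0 : (0 : ℝ) < Fintype.card F := by linarith
  by_cases h : n < 2 * (d + 1)
  · rw [BB_empty F n _ h]; simp
    refine mul_nonneg (by positivity) ?_
    have := pow_le_pow_of_le_one (a := (Fintype.card F : ℝ)⁻¹) (by positivity)
      (inv_le_one_of_one_le₀ hq) (show d + 1 ≤ d + 2 by omega)
    simpa using this
  obtain ⟨m, rfl⟩ : ∃ m, n = m + 2 * (d + 1) := ⟨n - 2 * (d + 1), by omega⟩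
  have h1 := (BB_ncard F (m + 2 * (d + 1)) (d + 1)).trans
    (Nat.mul_le_mul_right _ (PP_ncard F d hd))
  rw [Nat.add_sub_cancel] at h1
  have h2 : ((BB F (m + 2 * (d + 1)) (d + 1)).ncard : ℝ) ≤
      (Fintype.card F : ℝ) ^ d * ((Fintype.card F : ℝ) - 1) * (Fintype.card F : ℝ) ^ m := by
    have h3 : ((Fintype.card F - 1 : ℕ) : ℝ) = (Fintype.card F : ℝ) - 1 := by
      rw [Nat.cast_sub Fintype.card_pos, Nat.cast_one]
    rw [← h3]
    exact_mod_cast h1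
  refine h2.trans (le_of_eq ?_)
  rw [inv_pow, inv_pow]
  field_simp
  ring

lemma SS_ncard (F : Type*) [Field F] [Fintype F] (n : ℕ) :
    ((SS F n).ncard : ℝ) ≤ (Fintype.card F : ℝ) ^ n * (3 / 4) := by
  have hq : (2 : ℝ) ≤ Fintype.card F := by exact_mod_cast Fintype.one_lt_card (α := F)
  have hfin : ∀ d, (BB F n d).Finite := fun d => (MM_finite F n).subset fun f h => h.1
  have key : ∀ D : ℕ, ((⋃ d ∈ Finset.Icc 1 (D + 1), BB F n d).ncard : ℝ) ≤
      (Fintype.card F : ℝ) ^ n * ((Fintype.card F : ℝ)⁻¹ + (Fintype.card F : ℝ)⁻¹ ^ 2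
        - (Fintype.card F : ℝ)⁻¹ ^ (D + 2)) := by
    intro D
    induction D with
    | zero => simpa using BB_real_one F n
    | succ D ih =>
      have h1 : (⋃ d ∈ Finset.Icc 1 (D + 1 + 1), BB F n d) =
          (⋃ d ∈ Finset.Icc 1 (D + 1), BB F n d) ∪ BB F n (D + 1 + 1) := by
        ext f
        simp only [Set.mem_iUnion, Set.mem_union, Finset.mem_Icc, exists_prop]
        constructor
        · rintro ⟨d, hd, hf⟩
          by_cases h : d = D + 1 + 1
          · right; rwa [← h]
          · left; exact ⟨d, by omega, hf⟩
        · rintro (⟨d, hd, hf⟩ | hf)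
          · exact ⟨d, by omega, hf⟩
          · exact ⟨_, by omega, hf⟩
      rw [h1]
      have h2 : (((⋃ d ∈ Finset.Icc 1 (D + 1), BB F n d) ∪ BB F n (D + 1 + 1)).ncard : ℝ) ≤
        ((⋃ d ∈ Finset.Icc 1 (D + 1), BB F n d).ncard : ℝ) + ((BB F n (D + 1 + 1)).ncard : ℝ) := by
        exact_mod_cast Set.ncard_union_le _ _
      have h3 := BB_real F n (D + 1) (by omega)
      refine (h2.trans (add_le_add ih h3)).trans (le_of_eq ?_)
      ring
  have hsub : SS F n ⊆ ⋃ d ∈ Finset.Icc 1 (n + 1), BB F n d := by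
    rintro f ⟨hf, l, hm, hi, hdvd⟩
    simp only [Set.mem_iUnion, Finset.mem_Icc, exists_prop]
    refine ⟨l.natDegree, ⟨hi.natDegree_pos, ?_⟩, hf, l, ⟨hm, hi, rfl⟩, hdvd⟩
    have := Polynomial.natDegree_le_of_dvd hdvd hf.1.ne_zero
    rw [hm.natDegree_pow, hf.2] at this
    omega
  have hle : ((SS F n).ncard : ℝ) ≤ ((⋃ d ∈ Finset.Icc 1 (n + 1), BB F n d).ncard : ℝ) := by
    exact_mod_cast Set.ncard_le_ncard hsub
      (Set.Finite.biUnion (Finset.finite_toSet _) fun d _ => hfin d)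
  refine (hle.trans (key n)).trans ?_
  refine mul_le_mul_of_nonneg_left ?_ (by positivity)
  have hi : (Fintype.card F : ℝ)⁻¹ ≤ 1 / 2 := by
    rw [one_div]; exact inv_anti₀ (by norm_num) hq
  have hi0 : 0 ≤ (Fintype.card F : ℝ)⁻¹ := by positivity
  have : 0 ≤ (Fintype.card F : ℝ)⁻¹ ^ (n + 2) := by positivity
  nlinarith

lemma omegak_pos_of (F : Type*) [Field F] [Fintype F] (k : ℕ) (f l : F[X]) (hf : f ≠ 0)
    (hk : 1 ≤ k)
    (hl : l.Monic ∧ Irreducible l ∧ l ^ k ∣ f ∧ ¬ l ^ (k + 1) ∣ f) : 1 ≤ omegak F k f := by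
  have hfin : {l : F[X] | l.Monic ∧ Irreducible l ∧ l ^ k ∣ f ∧ ¬ l ^ (k + 1) ∣ f}.Finite := by
    refine Set.Finite.subset (Set.Finite.biUnion (Finset.finite_toSet (Finset.range (f.natDegree + 1)))
      fun d _ => MM_finite F d) ?_
    rintro l ⟨hm, hi, hd, -⟩
    simp only [Set.mem_iUnion, exists_prop]
    refine ⟨l.natDegree, ?_, hm, rfl⟩
    have := Polynomial.natDegree_le_of_dvd ((dvd_pow_self l (by omega : k ≠ 0)).trans hd) hf
    simp; omega
  have : Finite {l : F[X] // l.Monic ∧ Irreducible l ∧ l ^ k ∣ f ∧ ¬ l ^ (k + 1) ∣ f} := hfin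
  have : Nonempty {l : F[X] // l.Monic ∧ Irreducible l ∧ l ^ k ∣ f ∧ ¬ l ^ (k + 1) ∣ f} :=
    ⟨⟨l, hl⟩⟩
  exact Nat.card_pos

/-- For k ≥ 2, ω_k has no normal order: for every non-negative function G on monic
polynomials that is non-decreasing with respect to the degree, there is an ε > 0 such
that the number of monic degree-n polynomials failing
(1-ε)G(f) ≤ ω_k(f) ≤ (1+ε)G(f) is not o(qⁿ). -/
theorem omega_k_no_normal_order (F : Type*) [Field F] [Fintype F] (k : ℕ) (hk : 2 ≤ k)
    (G : Polynomial F → ℝ) (hG0 : ∀ f, 0 ≤ G f)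
    (hGmono : ∀ f h : Polynomial F, f.Monic → h.Monic →
      h.natDegree ≤ f.natDegree → G h ≤ G f) :
    ∃ ε : ℝ, 0 < ε ∧
      ¬ ((fun n : ℕ =>
          (Nat.card {f : Polynomial F // f.Monic ∧ f.natDegree = n ∧
            ¬((1 - ε) * G f ≤ (omegak F k f : ℝ) ∧
              (omegak F k f : ℝ) ≤ (1 + ε) * G f)} : ℝ))
        =o[atTop] (fun n : ℕ => (Fintype.card F : ℝ) ^ n)) := by
  refine ⟨1 / 2, by norm_num, fun hO => ?_⟩
  have hq : (2 : ℝ) ≤ Fintype.card F := by exact_mod_cast Fintype.one_lt_card (α := F)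
  have hq0 : (0 : ℝ) < Fintype.card F := by linarith
  set q : ℝ := (Fintype.card F : ℝ) with hqdef
  have hc : 0 < (2 * q ^ (k + 1))⁻¹ := by positivity
  obtain ⟨n, hb, hn⟩ := ((hO.bound hc).and (eventually_ge_atTop (k + 1))).exists
  rw [Real.norm_of_nonneg (by positivity), Real.norm_of_nonneg (by positivity)] at hb
  set B : Set F[X] := {f : Polynomial F | f.Monic ∧ f.natDegree = n ∧
            ¬((1 - 1 / 2 : ℝ) * G f ≤ (omegak F k f : ℝ) ∧
              (omegak F k f : ℝ) ≤ (1 + 1 / 2) * G f)} with hB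
  have hBfin : B.Finite := (MM_finite F n).subset fun f h => ⟨h.1, h.2.1⟩
  have hb' : (B.ncard : ℝ) ≤ (2 * q ^ (k + 1))⁻¹ * q ^ n := by
    rw [← Nat.card_coe_set_eq]; exact hb
  have hGc : ∀ f ∈ MM F n, G f = G (X ^ n) := by
    rintro f ⟨hm, hd⟩
    refine le_antisymm (hGmono _ _ (monic_X_pow n) hm ?_) (hGmono _ _ hm (monic_X_pow n) ?_) <;>
      simp [hd]
  rcases (hG0 (X ^ n)).eq_or_lt with h0 | hpos
  · obtain ⟨m, rfl⟩ : ∃ m, n = m + (k + 1) := ⟨n - (k + 1), by omega⟩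
    have hle : (MM F m).ncard ≤ B.ncard := by
      refine Set.ncard_le_ncard_of_injOn (fun h => X ^ k * (h * X + C 1)) ?_ ?_ hBfin
      · rintro h ⟨hm, hd⟩
        have hdeg : (C (1 : F)).degree < (h * X).degree := by
          rw [(monic_X).degree_mul, degree_X, degree_eq_natDegree hm.ne_zero, degree_C one_ne_zero]
          exact_mod_cast Nat.succ_pos _
        have hm1 : (h * X + C 1).Monic := (hm.mul monic_X).add_of_left hdeg
        have hd1 : (h * X + C 1).natDegree = m + 1 := by
          rw [natDegree_add_C, natDegree_mul_X hm.ne_zero, hd]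
        have hm2 : (X ^ k * (h * X + C 1)).Monic := (monic_X_pow k).mul hm1
        have hd2 : (X ^ k * (h * X + C 1)).natDegree = m + (k + 1) := by
          rw [(monic_X_pow k).natDegree_mul hm1, hd1, natDegree_X_pow]; omega
        refine ⟨hm2, hd2, ?_⟩
        rintro ⟨-, h2⟩
        rw [hGc _ ⟨hm2, hd2⟩, ← h0, mul_zero] at h2
        have h3 : 1 ≤ omegak F k (X ^ k * (h * X + C 1)) := by
          refine omegak_pos_of F k _ X hm2.ne_zero (by omega)
            ⟨monic_X, irreducible_X, dvd_mul_right _ _, ?_⟩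
          rw [pow_succ, mul_dvd_mul_iff_left (pow_ne_zero _ X_ne_zero), X_dvd_iff]
          simp
        have h4 : (1 : ℝ) ≤ omegak F k (X ^ k * (h * X + C 1)) := by exact_mod_cast h3
        linarith
      · intro a _ b _ hab
        have h1 := mul_left_cancel₀ (pow_ne_zero k (X_ne_zero (R := F))) hab
        exact mul_right_cancel₀ X_ne_zero (add_right_cancel h1)
    rw [MM_ncard] at hle
    have hle' : q ^ m ≤ (B.ncard : ℝ) := by rw [hqdef]; exact_mod_cast hle
    have heq : (2 * q ^ (k + 1))⁻¹ * q ^ (m + (k + 1)) = q ^ m / 2 := by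
      field_simp; ring
    rw [heq] at hb'
    have : 0 < q ^ m := by positivity
    linarith
  · have hsub : MM F n ⊆ B ∪ SS F n := by
      intro f hf
      by_cases hs : f ∈ SS F n
      · exact Or.inr hs
      · left
        refine ⟨hf.1, hf.2, ?_⟩
        rintro ⟨h1, -⟩
        have hz : omegak F k f = 0 := by
          have : IsEmpty {l : F[X] // l.Monic ∧ Irreducible l ∧ l ^ k ∣ f ∧ ¬ l ^ (k + 1) ∣ f} :=
            ⟨fun l => hs ⟨hf, l.1, l.2.1, l.2.2.1, (pow_dvd_pow _ hk).trans l.2.2.2.1⟩⟩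
          exact Nat.card_of_isEmpty
        rw [hz, hGc f hf] at h1
        norm_num at h1
        linarith
    have hSfin : (SS F n).Finite := (MM_finite F n).subset fun f h => h.1
    have h1 := (Set.ncard_le_ncard hsub (hBfin.union hSfin)).trans (Set.ncard_union_le _ _)
    rw [MM_ncard] at h1
    have h2 : q ^ n ≤ (B.ncard : ℝ) + ((SS F n).ncard : ℝ) := by rw [hqdef]; exact_mod_cast h1
    have h3 := SS_ncard F n
    have h4 : (2 * q ^ (k + 1))⁻¹ ≤ 1 / 8 := by
      rw [one_div]
      refine inv_anti₀ (by norm_num) ?_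
      have : (2 : ℝ) ^ 2 ≤ q ^ (k + 1) :=
        (pow_le_pow_left₀ (by norm_num) hq 2).trans (pow_le_pow_right₀ (by linarith) (by omega))
      linarith
    have h5 : 0 < q ^ n := by positivity
    have h6 := mul_le_mul_of_nonneg_right h4 h5.le
    linarith
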